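/- Let S be a compact connected Hausdorff topological 2-manifold (a closed surface), let f : S → S be a homeomorphism preserving a finite Borel measure μ on S with full support (μ(V) > 0 for every nonempty open V), and let U ⊆ S be an open simply connected f-invariant set such that S∖U has more than one point. Then there is no ∞-translation arc for f intersecting both U and its complement S∖U. -/

import Mathlib

open Set Topology Filter

noncomputable section

universe u

variable {X : Type u} [TopologicalSpace X]

/-- A homeomorphism is *orientation preserving* if it is isotopic to the identity. -/
def IsOrientationPreserving (f : X ≃ₜ X) : Prop :=
  ∃ H : unitInterval × X → X,
    Continuous H ∧ (∀ x, H (0, x) = x) ∧ (∀ x, H (1, x) = f x) ∧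
      ∀ t : unitInterval, IsHomeomorph fun x => H (t, x)

/-- `D` is a connected component of `A`. -/
def IsCompOf (A D : Set X) : Prop := ∃ x ∈ A, D = connectedComponentIn A x

/-- `A` has exactly two connected components, the distinct sets `D₁` and `D₂`. -/
def HasTwoComps (A D₁ D₂ : Set X) : Prop :=
  IsCompOf A D₁ ∧ IsCompOf A D₂ ∧ D₁ ≠ D₂ ∧
    ∀ x ∈ A, connectedComponentIn A x = D₁ ∨ connectedComponentIn A x = D₂

/-- A *cross-cut* of the open set `U`: the image of an arc `g` on `(0,1)`, where `g` is
continuous and injective on `[0,1]`'s interior, runs inside `U`, has endpoints on `∂U`, and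
separates `U` into exactly two components, each with a boundary point on `∂U` away from the
closed arc. -/
def IsCrossCut (U γ : Set X) : Prop :=
  ∃ g : ℝ → X,
    ContinuousOn g (Icc 0 1) ∧ InjOn g (Ioo 0 1) ∧ (∀ t ∈ Ioo (0:ℝ) 1, g t ∈ U) ∧
      g 0 ∈ frontier U ∧ g 1 ∈ frontier U ∧ γ = g '' Ioo 0 1 ∧
      ∃ D₁ D₂ : Set X, HasTwoComps (U \ γ) D₁ D₂ ∧
        (frontier D₁ ∩ (frontier U \ g '' Icc 0 1)).Nonempty ∧
        (frontier D₂ ∩ (frontier U \ g '' Icc 0 1)).Nonempty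

/-- A *cross-section* of `U`: a connected component of `U ∖ γ` for a cross-cut `γ`. -/
def IsCrossSection (U D : Set X) : Prop := ∃ γ : Set X, IsCrossCut U γ ∧ IsCompOf (U \ γ) D

/-- The image of a set under the `k`-th integer iterate of a homeomorphism. -/
def iterZ (f : X ≃ₜ X) (k : ℤ) (A : Set X) : Set X := ⇑(f.toEquiv ^ k) '' A

/-- A cross-section of `U` which is wandering for `f^n`. -/
def IsWanderingSection (f : X ≃ₜ X) (U : Set X) (n : ℕ) (D : Set X) : Prop :=
  IsCrossSection U D ∧ ∀ k : ℤ, k ≠ 0 → iterZ f ((n : ℤ) * k) D ∩ D = ∅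

/-- `f` is ∂-nonwandering in `U`. -/
def BdNonwandering (f : X ≃ₜ X) (U : Set X) : Prop :=
  ∀ n : ℕ, 1 ≤ n → ∃ K : Set X, IsCompact K ∧ K ⊆ U ∧
    ∀ D : Set X, IsWanderingSection f U n D →
      (∃ k : ℤ, 0 < k ∧ (iterZ f ((n : ℤ) * k) D ∩ K).Nonempty) ∧
      (∃ k : ℤ, k < 0 ∧ (iterZ f ((n : ℤ) * k) D ∩ K).Nonempty)

/-- The boundary of `D` inside `U` (for `D` open in `U`). -/
def bdIn (U D : Set X) : Set X := (closure D \ D) ∩ U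

/-- A chain of cross-sections of `U`. -/
def IsPEChain (U : Set X) (D : ℕ → Set X) : Prop :=
  (∀ i, IsCrossSection U (D i)) ∧ (∀ i j : ℕ, j ≤ i → D i ⊆ D j) ∧
    ∀ i j : ℕ, i ≠ j → closure (bdIn U (D i)) ∩ closure (bdIn U (D j)) = ∅

/-- The chain `D` divides the cross-section `E`. -/
def ChainDividesSection (D : ℕ → Set X) (E : Set X) : Prop := ∃ N : ℕ, ∀ i, N ≤ i → D i ⊆ E

/-- The chain `D` divides the chain `D'`. -/
def ChainDivides (D D' : ℕ → Set X) : Prop := ∀ n : ℕ, ∃ m : ℕ, D m ⊆ D' n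

/-- A prime chain: a chain dividing every chain that divides it. -/
def IsPrimeChain (U : Set X) (D : ℕ → Set X) : Prop :=
  IsPEChain U D ∧ ∀ D' : ℕ → Set X, IsPEChain U D' → ChainDivides D' D → ChainDivides D D'

/-- The type of prime chains of `U`. -/
def PrimeChain (U : Set X) : Type u := {D : ℕ → Set X // IsPrimeChain U D}

/-- A prime end of `U`: an equivalence class of prime chains. -/
def PrimeEnd (U : Set X) : Type u :=
  Quot fun C C' : PrimeChain U => ChainDivides C.1 C'.1 ∧ ChainDivides C'.1 C.1

/-- The prime end `p` divides the cross-section `E`. -/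
def PrimeEndDivides {U : Set X} (p : PrimeEnd U) (E : Set X) : Prop :=
  ∃ C : PrimeChain U, Quot.mk _ C = p ∧ ChainDividesSection C.1 E

/-- The prime ends compactification of `U` (as a set: `U ⊔ (prime ends)`). -/
def PrimeEndComp (U : Set X) : Type u := ↥U ⊕ PrimeEnd U

/-- A point of `U`, as an element of the prime ends compactification. -/
def pePt (U : Set X) (x : ↥U) : PrimeEndComp U := Sum.inl x

/-- A prime end, as an element of the prime ends compactification. -/
def peEnd (U : Set X) (p : PrimeEnd U) : PrimeEndComp U := Sum.inr p

/-- The copy of a subset `V ⊆ U` inside the prime ends compactification. -/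
def peOpen (U V : Set X) : Set (PrimeEndComp U) := {z | ∃ x : ↥U, z = pePt U x ∧ (x : X) ∈ V}

/-- The basic set `E ∪ i_E(E)` of the prime ends compactification, for a cross-section `E`. -/
def peSection (U E : Set X) : Set (PrimeEndComp U) :=
  peOpen U E ∪ {z | ∃ p : PrimeEnd U, z = peEnd U p ∧ PrimeEndDivides p E}

/-- The topology of the prime ends compactification. -/
instance primeEndCompTopology (U : Set X) : TopologicalSpace (PrimeEndComp U) :=
  TopologicalSpace.generateFrom
    ({s | ∃ V : Set X, IsOpen V ∧ V ⊆ U ∧ s = peOpen U V} ∪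
      {s | ∃ E : Set X, IsCrossSection U E ∧ s = peSection U E})

/-- The circle of prime ends, as a subset of the prime ends compactification. -/
def PrimeEndCircle (U : Set X) : Set (PrimeEndComp U) := Set.range (peEnd U)

/-- `F` is an extension of `f|_U` to the prime ends compactification of `U`. -/
def IsPEExtension (f : X ≃ₜ X) (U : Set X) (F : PrimeEndComp U ≃ₜ PrimeEndComp U) : Prop :=
  ∀ (x : X) (hx : x ∈ U) (hfx : f x ∈ U), F (pePt U ⟨x, hx⟩) = pePt U ⟨f x, hfx⟩

/-- An end-cut of `U`: an injective arc in `U` defined on `[0,1)` converging in the ambient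
space as `t → 1⁻`. -/
def IsEndCut (U : Set X) (γ : ℝ → X) : Prop :=
  ContinuousOn γ (Ico 0 1) ∧ InjOn γ (Ico 0 1) ∧ (∀ t ∈ Ico (0:ℝ) 1, γ t ∈ U) ∧
    ∃ z : X, Tendsto γ (𝓝[<] (1:ℝ)) (𝓝 z)

/-- `z` is an accessible point of `∂U`. -/
def IsAccessiblePoint (U : Set X) (z : X) : Prop :=
  ∃ γ : ℝ → X, IsEndCut U γ ∧ Tendsto γ (𝓝[<] (1:ℝ)) (𝓝 z)

/-- `p` is an accessible prime end of `U`. -/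
def IsAccessiblePrimeEnd (U : Set X) (p : PrimeEnd U) : Prop :=
  ∃ (γ : ℝ → X) (hγ : ∀ t ∈ Ico (0:ℝ) 1, γ t ∈ U), IsEndCut U γ ∧
    Tendsto (fun t : ↥(Ico (0:ℝ) 1) => pePt U ⟨γ ↑t, hγ ↑t t.2⟩)
      (comap Subtype.val (𝓝[<] (1:ℝ))) (𝓝 (peEnd U p))

/-- A translation arc for `f` based at `x`: a simple arc from `x` to `f x` meeting its image
only as allowed. -/
def IsTranslationArc (f : X ≃ₜ X) (γ : Set X) (x : X) : Prop :=
  f x ≠ x ∧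
    ∃ g : ℝ → X, ContinuousOn g (Icc 0 1) ∧ InjOn g (Icc 0 1) ∧
      g 0 = x ∧ g 1 = f x ∧ γ = g '' Icc 0 1 ∧
      ((⇑f '' γ) ∩ γ = {f x} ∨ ((⇑f '' γ) ∩ γ = {x, f x} ∧ f (f x) = x))

/-- An `N`-translation arc for `f` based at `x` (for `N = 1` this is just a translation arc). -/
def IsNTranslationArc (f : X ≃ₜ X) (N : ℕ) (γ : Set X) (x : X) : Prop :=
  IsTranslationArc f γ x ∧
    (2 ≤ N →
      (∀ k : ℕ, 2 ≤ k → k ≤ N - 1 → (⇑f)^[k] '' γ ∩ γ = ∅) ∧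
        ((⇑f)^[N] '' γ ∩ γ = ∅ ∨ ((⇑f)^[N] '' γ ∩ γ = {x} ∧ (⇑f)^[N + 1] x = x)))

/-- An ∞-translation arc: an `N`-translation arc for every `N ≥ 1`. -/
def IsInfTranslationArc (f : X ≃ₜ X) (γ : Set X) (x : X) : Prop :=
  ∀ N : ℕ, 1 ≤ N → IsNTranslationArc f N γ x

/-- A nonwandering homeomorphism. -/
def IsNonwanderingMap (f : X → X) : Prop :=
  ∀ V : Set X, IsOpen V → V.Nonempty → ∃ n : ℕ, 1 ≤ n ∧ (f^[n] '' V ∩ V).Nonempty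

/-- A loop contained in `A` which is not null-homotopic in `V`. -/
def IsEssentialLoopIn (V A : Set X) : Prop :=
  ∃ (z : ↥V) (δ : Path z z), (∀ t : unitInterval, (↑(δ t) : X) ∈ A) ∧
    ¬ δ.Homotopic (Path.refl z)

/-- An annular continuum: a continuum with an open annular neighborhood `V` such that `V ∖ K`
has exactly two components, each essential in `V`. -/
def IsAnnularContinuum (K : Set X) : Prop :=
  IsCompact K ∧ IsConnected K ∧ K.Nontrivial ∧
    ∃ V : Set X, IsOpen V ∧ K ⊆ V ∧
      Nonempty (↥V ≃ₜ AddCircle (1 : ℝ) × ↥(Ioo (0 : ℝ) 1)) ∧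
      ∃ D₁ D₂ : Set X, HasTwoComps (V \ K) D₁ D₂ ∧
        IsEssentialLoopIn V D₁ ∧ IsEssentialLoopIn V D₂

/-- A set contractible in the ambient surface: it has an open neighborhood homeomorphic to the
plane. -/
def ContractibleInSurface (K : Set X) : Prop :=
  ∃ W : Set X, IsOpen W ∧ K ⊆ W ∧ Nonempty (↥W ≃ₜ (ℝ × ℝ))

/-- `α ∈ ℝ/ℤ` is rational. -/
def IsRationalAC (α : AddCircle (1 : ℝ)) : Prop := ∃ r : ℚ, α = ((r : ℝ) : AddCircle (1 : ℝ))

/-- The constant `q(α,g)`: the smallest positive integer `q` with `‖qα‖ = 0` if `α` is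
rational, and `(2g+1)‖qα‖ < ‖α‖` if `α` is irrational. -/
def qConst (α : AddCircle (1 : ℝ)) (g : ℕ) : ℕ :=
  sInf {q : ℕ | 0 < q ∧
    ((IsRationalAC α ∧ ‖q • α‖ = 0) ∨
      (¬IsRationalAC α ∧ ((2 * g + 1 : ℕ) : ℝ) * ‖q • α‖ < ‖α‖))}

/-! ### Continuous logarithms -/

/-- A nonvanishing continuous function on a simply connected open set has a logarithm. -/
theorem exists_continuousOn_log {Y : Type*} [TopologicalSpace Y] [LocallyPathConnectedSpace Y]
    {s : Set Y} (hs : IsOpen s) (hsc : SimplyConnectedSpace s) {g : Y → ℂ}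
    (hg : ContinuousOn g s) (hg0 : ∀ x ∈ s, g x ≠ 0) :
    ∃ l : Y → ℂ, ContinuousOn l s ∧ ∀ x ∈ s, Complex.exp (l x) = g x := by
  classical
  have : LocallyPathConnectedSpace s := hs.locallyPathConnectedSpace
  obtain ⟨a₀⟩ : Nonempty s := inferInstance
  obtain ⟨F, ⟨-, hF⟩, -⟩ := Complex.isCoveringMapOn_exp.existsUnique_continuousMap_lifts
    (f := ⟨s.domRestrict g, continuousOn_iff_continuous_domRestrict.1 hg⟩) (a₀ := a₀)
    (e₀ := Complex.log (g a₀)) (Complex.exp_log (hg0 _ a₀.2)) (fun a => hg0 _ a.2)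
  refine ⟨fun x => if hx : x ∈ s then F ⟨x, hx⟩ else 0, ?_, fun x hx => ?_⟩
  · rw [continuousOn_iff_continuous_domRestrict]
    convert! F.continuous using 1
    ext x
    simp
  · simpa [hx] using congrFun hF ⟨x, hx⟩

/-- A nonvanishing function which is continuous near a point has a logarithm near it. -/
theorem exists_continuousOn_log_nhds {Y : Type*} [TopologicalSpace Y] {O : Set Y} {p : Y}
    (hO : O ∈ 𝓝 p) {g : Y → ℂ} (hg : ContinuousOn g O) (hg0 : g p ≠ 0) :
    ∃ W : Set Y, IsOpen W ∧ p ∈ W ∧ W ⊆ O ∧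
      ∃ l : Y → ℂ, ContinuousOn l W ∧ ∀ x ∈ W, Complex.exp (l x) = g x := by
  have hgp : ContinuousAt g p := hg.continuousAt hO
  have h1 : ∀ᶠ x in 𝓝 p, g x / g p ∈ Complex.slitPlane := by
    refine (hgp.div_const (g p)).eventually_mem (Complex.isOpen_slitPlane.mem_nhds ?_)
    simp [hg0]
  obtain ⟨W, hW, hWo, hpW⟩ := eventually_nhds_iff.1 (h1.and hO)
  refine ⟨W, hWo, hpW, fun x hx => (hW x hx).2,
    fun x => Complex.log (g x / g p) + Complex.log (g p), ?_, fun x hx => ?_⟩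
  · exact (((hg.mono fun x hx => (hW x hx).2).div_const _).clog fun x hx => (hW x hx).1).add
      continuousOn_const
  · rw [Complex.exp_add, Complex.exp_log hg0,
      Complex.exp_log (Complex.slitPlane_ne_zero (hW x hx).1), div_mul_cancel₀ _ hg0]

/-- On a preconnected set, two continuous logarithms of the same function differ by a constant. -/
theorem IsPreconnected.sub_eq_sub_of_exp_eq {Y : Type*} [TopologicalSpace Y] {s : Set Y}
    (hs : IsPreconnected s) {l m : Y → ℂ} (hl : ContinuousOn l s) (hm : ContinuousOn m s)
    (h : ∀ x ∈ s, Complex.exp (l x) = Complex.exp (m x)) {x y : Y} (hx : x ∈ s) (hy : y ∈ s) :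
    l x - m x = l y - m y := by
  refine Complex.isCoveringMap_exp.isSeparatedMap.constOn_of_comp
    Complex.isCoveringMap_exp.isLocalHomeomorph.isLocallyInjective hs
    (g := fun z => l z - m z) (hl.sub hm) (fun a ha b hb => ?_) hx hy
  simp [Complex.exp_sub, h a ha, h b hb]

/-- There is no continuous logarithm of `z - a` in a punctured disc around `a`. -/
theorem not_exists_log_sub_punctured_ball {a : ℂ} {r : ℝ} (hr : 0 < r) :
    ¬∃ l : ℂ → ℂ, ContinuousOn l (Metric.ball a r \ {a}) ∧
      ∀ z ∈ Metric.ball a r \ {a}, Complex.exp (l z) = z - a := by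
  rintro ⟨l, hl, hle⟩
  set c : ℝ → ℂ := fun θ => a + Complex.exp (Real.log (r / 2) + θ * Complex.I) with hc
  have hnorm : ∀ θ, ‖c θ - a‖ = r / 2 := fun θ => by
    simp [hc, Complex.norm_exp, Real.exp_log (half_pos hr)]
  have hmem : ∀ θ, c θ ∈ Metric.ball a r \ {a} := fun θ => by
    refine ⟨?_, fun h => ?_⟩
    · rw [mem_ball_iff_norm, hnorm]
      linarith
    · have := hnorm θ
      rw [mem_singleton_iff.1 h, sub_self, norm_zero] at this
      linarith
  have hcc : Continuous c := by fun_prop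
  have key := isPreconnected_univ.sub_eq_sub_of_exp_eq (l := fun θ => l (c θ))
    (m := fun θ : ℝ => Real.log (r / 2) + θ * Complex.I)
    ((hl.comp_continuous hcc hmem).continuousOn) (by fun_prop)
    (fun θ _ => by rw [hle _ (hmem θ)]; simp [hc]) (mem_univ (0 : ℝ)) (mem_univ (2 * Real.pi))
  have hper : c 0 = c (2 * Real.pi) := by
    simp [hc, Complex.exp_add]
  simp only [hper] at key
  have h2 : (2 * Real.pi : ℂ) * Complex.I = 0 := by
    have := sub_right_injective key
    push_cast at this
    linear_combination -this
  exact Complex.two_pi_I_ne_zero h2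

/-- A nonvanishing continuous function on a punctured disc is a power of `z - a` times an
exponential. -/
theorem exists_eq_zpow_mul_exp_punctured_ball {a : ℂ} {r : ℝ} (hr : 0 < r) {g : ℂ → ℂ}
    (hg : ContinuousOn g (Metric.ball a r \ {a}))
    (hg0 : ∀ z ∈ Metric.ball a r \ {a}, g z ≠ 0) :
    ∃ (n : ℤ) (l : ℂ → ℂ), ContinuousOn l (Metric.ball a r \ {a}) ∧
      ∀ z ∈ Metric.ball a r \ {a}, g z = (z - a) ^ n * Complex.exp (l z) := by
  set H : Set ℂ := {w | w.re < Real.log r} with hH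
  have hHconv : Convex ℝ H := convex_halfSpace_re_lt _
  have hHo : IsOpen H := isOpen_lt Complex.continuous_re continuous_const
  have hHne : H.Nonempty := ⟨(Real.log r - 1 : ℝ), by simp [hH]⟩
  have : ContractibleSpace H := hHconv.contractibleSpace hHne
  have hmem : ∀ w ∈ H, a + Complex.exp w ∈ Metric.ball a r \ {a} := fun w hw => by
    refine ⟨?_, by simp⟩
    rw [mem_ball_iff_norm, add_sub_cancel_left, Complex.norm_exp]
    exact (Real.lt_log_iff_exp_lt hr).1 hw
  obtain ⟨k, hk, hke⟩ := exists_continuousOn_log hHo inferInstance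
    (g := fun w => g (a + Complex.exp w))
    (hg.comp (by fun_prop) hmem) (fun w hw => hg0 _ (hmem w hw))
  have hshift : ∀ w ∈ H, w + 2 * Real.pi * Complex.I ∈ H := fun w hw => by simpa [hH] using hw
  have hkshift : ContinuousOn (fun w => k (w + 2 * Real.pi * Complex.I)) H :=
    hk.comp (by fun_prop) hshift
  have hexp : ∀ w ∈ H, Complex.exp (k (w + 2 * Real.pi * Complex.I)) = Complex.exp (k w) :=
    fun w hw => by
      rw [hke _ (hshift w hw), hke w hw, Complex.exp_periodic]
  obtain ⟨n, hn⟩ : ∃ n : ℤ, ∀ w ∈ H,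
      k (w + 2 * Real.pi * Complex.I) = k w + n * (2 * Real.pi * Complex.I) := by
    obtain ⟨w₀, hw₀⟩ := hHne
    obtain ⟨n, hn⟩ := Complex.exp_eq_exp_iff_exists_int.1 (hexp w₀ hw₀)
    refine ⟨n, fun w hw => ?_⟩
    have := hHconv.isPreconnected.sub_eq_sub_of_exp_eq hkshift hk hexp hw hw₀
    linear_combination this + hn
  set P : ℂ → ℂ := fun w => k w - n * w with hP
  have hPc : ContinuousOn P H := hk.sub (by fun_prop)
  have hPper : ∀ w ∈ H, P (w + 2 * Real.pi * Complex.I) = P w := fun w hw => by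
    simp only [hP, hn w hw]
    ring
  have hlogH : ∀ z ∈ Metric.ball a r \ {a}, Complex.log (z - a) ∈ H := fun z hz => by
    have h0 : z - a ≠ 0 := sub_ne_zero.2 hz.2
    change (Complex.log (z - a)).re < Real.log r
    rw [Complex.log_re]
    exact Real.log_lt_log (norm_pos_iff.2 h0) (mem_ball_iff_norm.1 hz.1)
  refine ⟨n, fun z => P (Complex.log (z - a)), fun z hz => ContinuousAt.continuousWithinAt ?_,
    fun z hz => ?_⟩
  · have h0 : z - a ≠ 0 := sub_ne_zero.2 hz.2
    by_cases hsl : z - a ∈ Complex.slitPlane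
    · exact ContinuousAt.comp (f := fun z => Complex.log (z - a))
        (hPc.continuousAt (hHo.mem_nhds (hlogH z hz)))
        (ContinuousAt.clog (by fun_prop) hsl)
    · have hsl' : -(z - a) ∈ Complex.slitPlane := by
        rw [Complex.mem_slitPlane_iff] at hsl ⊢
        push Not at hsl
        rcases hsl.1.lt_or_eq with h | h
        · left; simpa using h
        · exact absurd (Complex.ext h hsl.2) h0
      have hbr : ∀ᶠ y in 𝓝 z, y ∈ Metric.ball a r \ {a} :=
        (Metric.isOpen_ball.sdiff isClosed_singleton).mem_nhds hz
      have hc : ContinuousAt (fun y => P (Complex.log (-(y - a)) + Real.pi * Complex.I)) z := by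
        refine ContinuousAt.comp (f := fun y => Complex.log (-(y - a)) + Real.pi * Complex.I)
          (hPc.continuousAt (hHo.mem_nhds ?_))
          (ContinuousAt.add (ContinuousAt.clog (f := fun y => -(y - a)) (by fun_prop) hsl')
            continuousAt_const)
        have := hlogH z hz
        simpa [hH, Complex.log_re, norm_sub_rev] using this
      refine hc.congr (hbr.mono fun y hy => ?_)
      have hy0 : y - a ≠ 0 := sub_ne_zero.2 hy.2
      have hyH : Complex.log (-(y - a)) + Real.pi * Complex.I ∈ H := by
        have := hlogH y hy
        simpa [hH, Complex.log_re, norm_sub_rev] using this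
      obtain ⟨m, hm⟩ := Complex.exp_eq_exp_iff_exists_int.1
        (show Complex.exp (Complex.log (-(y - a)) + Real.pi * Complex.I) =
          Complex.exp (Complex.log (y - a)) by
          rw [Complex.exp_add, Complex.exp_log (neg_ne_zero.2 hy0), Complex.exp_pi_mul_I,
            Complex.exp_log hy0]
          ring)
      have hPerInt : ∀ (j : ℕ) (w : ℂ), w ∈ H → w + j * (2 * Real.pi * Complex.I) ∈ H ∧
          P (w + j * (2 * Real.pi * Complex.I)) = P w := by
        intro j
        induction j with
        | zero => intro w hw; simpa using hw
        | succ j ih =>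
          intro w hw
          obtain ⟨h1, h2⟩ := ih w hw
          have e : w + (j + 1 : ℕ) * (2 * Real.pi * Complex.I) =
            w + j * (2 * Real.pi * Complex.I) + 2 * Real.pi * Complex.I := by push_cast; ring
          rw [e]
          exact ⟨hshift _ h1, (hPper _ h1).trans h2⟩
      rcases Int.eq_nat_or_neg m with ⟨j, rfl | rfl⟩
      · simp only [hm]
        exact (hPerInt j _ (hlogH y hy)).2
      · have : Complex.log (y - a) =
            Complex.log (-(y - a)) + Real.pi * Complex.I + j * (2 * Real.pi * Complex.I) := by
          rw [hm]; push_cast; ring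
        simp only [this]
        exact (hPerInt j _ hyH).2.symm
  · have h0 : z - a ≠ 0 := sub_ne_zero.2 hz.2
    have h1 := hke _ (hlogH z hz)
    simp only [Complex.exp_log h0, add_sub_cancel] at h1
    rw [← h1, hP, Complex.exp_sub, Complex.exp_int_mul, Complex.exp_log h0]
    field_simp [zpow_ne_zero n h0]

/-- The function `(z - c s) / (z - c t)` has a continuous logarithm off the path `c`. -/
theorem exists_log_div_compl_path {c : ℝ → ℂ} {s t : ℝ} (hst : s ≤ t)
    (hc : ContinuousOn c (Icc s t)) :
    ∃ l : ℂ → ℂ, ContinuousOn l (c '' Icc s t)ᶜ ∧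
      ∀ z ∈ (c '' Icc s t)ᶜ, Complex.exp (l z) = (z - c s) / (z - c t) := by
  classical
  set K : Set ℂ := c '' Icc s t with hK
  set c' : unitInterval → ℂ := fun τ => c (s + τ * (t - s)) with hc'
  have hmemIcc : ∀ τ : unitInterval, s + (τ : ℝ) * (t - s) ∈ Icc s t := fun τ => by
    constructor <;> nlinarith [τ.2.1, τ.2.2]
  have hc'c : Continuous c' := hc.comp_continuous (by fun_prop) hmemIcc
  have hc'K : ∀ τ, c' τ ∈ K := fun τ => mem_image_of_mem _ (hmemIcc τ)
  have hne : ∀ (τ : unitInterval) (z : (Kᶜ : Set ℂ)), (z : ℂ) - c' τ ≠ 0 := fun τ z h =>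
    z.2 (by rw [sub_eq_zero.1 h]; exact hc'K τ)
  have h0 : c' 0 = c s := by simp [hc']
  have h1 : c' 1 = c t := by simp [hc']
  let G : C(unitInterval × (Kᶜ : Set ℂ), {z : ℂ // z ≠ 0}) :=
    ⟨fun q => ⟨((q.2 : ℂ) - c' 0) / ((q.2 : ℂ) - c' q.1), div_ne_zero (hne _ _) (hne _ _)⟩,
      Continuous.subtype_mk (Continuous.div (by fun_prop) (by fun_prop) fun q => hne _ _) _⟩
  let F := Complex.isCoveringMap_exp.liftHomotopy G (ContinuousMap.const _ 0)
    (fun z => by simp [G, hne])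
  have hF : ∀ q, Complex.exp (F q) = ((q.2 : ℂ) - c' 0) / ((q.2 : ℂ) - c' q.1) := fun q =>
    congrArg Subtype.val (congrFun (Complex.isCoveringMap_exp.liftHomotopy_lifts G _ _) q)
  refine ⟨fun z => if hz : z ∈ Kᶜ then F (1, ⟨z, hz⟩) else 0, ?_, fun z hz => ?_⟩
  · rw [continuousOn_iff_continuous_domRestrict]
    have : Continuous fun z : (Kᶜ : Set ℂ) => F (1, z) := by fun_prop
    convert! this using 1
    ext x
    exact dif_pos x.2
  · have := hF (1, ⟨z, hz⟩)
    rw [h0, h1] at this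
    simpa only [dif_pos hz] using this

/-! ### Winding functions of arcs in a surface -/

section Winding

variable {Y : Type*} [TopologicalSpace Y]

/-- Urysohn cutoff functions which are locally constant near the two prescribed sets. -/
theorem exists_continuous_cutoff [NormalSpace Y] {K O : Set Y} (hK : IsClosed K) (hO : IsOpen O)
    (hKO : K ⊆ O) :
    ∃ χ : Y → ℂ, Continuous χ ∧
      (∃ V, IsOpen V ∧ K ⊆ V ∧ V ⊆ O ∧ ∀ x ∈ V, χ x = 1) ∧
      ∃ V', IsOpen V' ∧ Oᶜ ⊆ V' ∧ ∀ x ∈ V', χ x = 0 := by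
  obtain ⟨V, hV, hKV, hVO⟩ := normal_exists_closure_subset hK hO hKO
  obtain ⟨W, hW, hVW, hWO⟩ := normal_exists_closure_subset isClosed_closure hO hVO
  obtain ⟨g, hg0, hg1, -⟩ := exists_continuous_zero_one_of_isClosed (hW.isClosed_compl)
    (isClosed_closure (s := V)) (disjoint_compl_left_iff_subset.2 hVW)
  refine ⟨fun x => (g x : ℂ), by fun_prop,
    ⟨V, hV, hKV, subset_closure.trans hVO, fun x hx => ?_⟩,
    (closure W)ᶜ, isClosed_closure.isOpen_compl, compl_subset_compl.2 hWO, fun x hx => ?_⟩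
  · simp [hg1 (subset_closure hx)]
  · simp [hg0 fun h => hx (subset_closure h)]

theorem continuousOn_cutoff_mul {K O V' : Set Y} (hK : IsClosed K) (hO : IsOpen O)
    {χ l : Y → ℂ} (hχ : Continuous χ) (hV' : IsOpen V') (hOV' : Oᶜ ⊆ V')
    (hχ0 : ∀ x ∈ V', χ x = 0) (hl : ContinuousOn l (O \ K)) :
    ContinuousOn (fun x => χ x * l x) Kᶜ := by
  intro x hx
  refine ContinuousAt.continuousWithinAt ?_
  by_cases hxO : x ∈ O
  · exact hχ.continuousAt.mul (hl.continuousAt ((hO.sdiff hK).mem_nhds ⟨hxO, hx⟩))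
  · refine (continuousAt_const (y := (0 : ℂ))).congr ?_
    filter_upwards [hV'.mem_nhds (hOV' hxO)] with y hy
    simp [hχ0 y hy]

/-- The local building block: for an arc contained in a chart domain, a function with a simple
zero at the first endpoint and a simple pole at the last one, together with its logarithm
off the arc. -/
theorem exists_winding_chart [T2Space Y] [NormalSpace Y] (e : OpenPartialHomeomorph Y ℂ)
    {h : ℝ → Y} {s t : ℝ} (hst : s ≤ t) (hc : ContinuousOn h (Icc s t))
    (hsub : h '' Icc s t ⊆ e.source) :
    ∃ ψ φ : Y → ℂ, ContinuousOn ψ (h '' Icc s t)ᶜ ∧ ContinuousOn φ {h s, h t}ᶜ ∧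
      (∀ x ∈ ({h s, h t} : Set Y)ᶜ, φ x ≠ 0) ∧
      (∀ x ∈ (h '' Icc s t)ᶜ, φ x = Complex.exp (ψ x)) ∧
      ∃ V, IsOpen V ∧ h '' Icc s t ⊆ V ∧ V ⊆ e.source ∧
        ∀ x ∈ V, φ x = (e x - e (h s)) / (e x - e (h t)) := by
  classical
  set A : Set Y := h '' Icc s t with hA
  have hAc : IsClosed A := (isCompact_Icc.image_of_continuousOn hc).isClosed
  have hsA : h s ∈ A := mem_image_of_mem _ (left_mem_Icc.2 hst)
  have htA : h t ∈ A := mem_image_of_mem _ (right_mem_Icc.2 hst)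
  obtain ⟨l, hl, hle⟩ := exists_log_div_compl_path hst
    (c := e ∘ h) (e.continuousOn.comp hc fun x hx => hsub (mem_image_of_mem _ hx))
  have hmaps : ∀ x ∈ e.source \ A, e x ∈ ((e ∘ h) '' Icc s t)ᶜ := by
    rintro x ⟨hx, hxA⟩ ⟨τ, hτ, hτx⟩
    exact hxA ⟨τ, hτ, e.injOn (hsub (mem_image_of_mem _ hτ)) hx hτx⟩
  obtain ⟨χ, hχ, ⟨V, hV, hAV, hVs, hχ1⟩, V', hV', hsV', hχ0⟩ :=
    exists_continuous_cutoff hAc e.open_source hsub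
  have hψ : ContinuousOn (fun x => χ x * l (e x)) Aᶜ :=
    continuousOn_cutoff_mul hAc e.open_source hχ hV' hsV' hχ0
      (hl.comp (e.continuousOn.mono sdiff_subset) hmaps)
  have hagree : ∀ x ∈ V \ A, Complex.exp (χ x * l (e x)) =
      (e x - e (h s)) / (e x - e (h t)) := fun x hx => by
    rw [hχ1 x hx.1, one_mul, hle _ (hmaps x ⟨hVs hx.1, hx.2⟩)]
    rfl
  have hne : ∀ x ∈ V, ∀ y ∈ A, x ≠ y → e x - e y ≠ 0 := fun x hx y hy hxy h0 =>
    hxy (e.injOn (hVs hx) (hsub hy) (sub_eq_zero.1 h0))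
  refine ⟨fun x => χ x * l (e x), fun x => if x ∈ V then (e x - e (h s)) / (e x - e (h t))
    else Complex.exp (χ x * l (e x)), hψ, fun x hx => ContinuousAt.continuousWithinAt ?_,
    fun x hx => ?_, fun x hx => ?_, V, hV, hAV, hVs, fun x hx => if_pos hx⟩
  · simp only [mem_compl_iff, mem_insert_iff, mem_singleton_iff, not_or] at hx
    by_cases hxV : x ∈ V
    · have he : ContinuousAt e x := e.continuousAt (hVs hxV)
      have : ContinuousAt (fun x => (e x - e (h s)) / (e x - e (h t))) x :=
        (he.sub continuousAt_const).div (he.sub continuousAt_const) (hne x hxV _ htA hx.2)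
      refine this.congr ?_
      filter_upwards [hV.mem_nhds hxV] with y hy
      simp [hy]
    · have hxA : x ∈ Aᶜ := fun h => hxV (hAV h)
      refine ((hψ.continuousAt (hAc.isOpen_compl.mem_nhds hxA)).cexp).congr ?_
      filter_upwards [hAc.isOpen_compl.mem_nhds hxA] with y hy
      split_ifs with hyV
      · exact hagree y ⟨hyV, hy⟩
      · rfl
  · simp only [mem_compl_iff, mem_insert_iff, mem_singleton_iff, not_or] at hx
    dsimp only
    split_ifs with hxV
    · exact div_ne_zero (hne x hxV _ hsA hx.1) (hne x hxV _ htA hx.2)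
    · exact Complex.exp_ne_zero _
  · dsimp only
    split_ifs with hxV
    · exact (hagree x ⟨hxV, hx⟩).symm
    · rfl

/-- The arc `h` restricted to `[0, t]` has a winding function: a nonvanishing continuous function
off the endpoints, with a logarithm off the arc, but with no logarithm around the
initial endpoint. -/
def HasWindingFunction (h : ℝ → Y) (t : ℝ) : Prop :=
  ∃ ψ Θ : Y → ℂ, ContinuousOn ψ (h '' Icc 0 t)ᶜ ∧ ContinuousOn Θ {h 0, h t}ᶜ ∧
    (∀ x ∈ ({h 0, h t} : Set Y)ᶜ, Θ x ≠ 0) ∧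
    (∀ x ∈ (h '' Icc 0 t)ᶜ, Θ x = Complex.exp (ψ x)) ∧
    ∀ W ∈ 𝓝 (h 0), ¬∃ l : Y → ℂ, ContinuousOn l (W \ {h 0}) ∧
      ∀ x ∈ W \ {h 0}, Complex.exp (l x) = Θ x

theorem hasWindingFunction_of_chart [T2Space Y] [NormalSpace Y] (e : OpenPartialHomeomorph Y ℂ)
    {h : ℝ → Y} {t : ℝ} (ht : 0 < t) (hc : ContinuousOn h (Icc 0 t)) (hi : InjOn h (Icc 0 t))
    (hsub : h '' Icc 0 t ⊆ e.source) : HasWindingFunction h t := by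
  obtain ⟨ψ, φ, hψ, hφ, hφ0, hφψ, V, hV, hAV, hVs, hφe⟩ := exists_winding_chart e ht.le hc hsub
  refine ⟨ψ, φ, hψ, hφ, hφ0, hφψ, ?_⟩
  rintro W hW ⟨l, hl, hle⟩
  have h0 : h 0 ∈ V := hAV (mem_image_of_mem _ (left_mem_Icc.2 ht.le))
  have hts : h t ∈ e.source := hsub (mem_image_of_mem _ (right_mem_Icc.2 ht.le))
  have hne : e (h 0) - e (h t) ≠ 0 := fun h' => ht.ne
    (hi (left_mem_Icc.2 ht.le) (right_mem_Icc.2 ht.le) (e.injOn (hVs h0) hts (sub_eq_zero.1 h')))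
  obtain ⟨W', hW', h0W', hW'sub, m, hm, hme⟩ := exists_continuousOn_log_nhds
    (p := h 0) (O := V ∩ W) (g := fun x => e x - e (h t)) (inter_mem (hV.mem_nhds h0) hW)
    ((e.continuousOn.mono fun x hx => hVs hx.1).sub continuousOn_const) hne
  have hW't : IsOpen (e.target ∩ e.symm ⁻¹' W') := e.isOpen_inter_preimage_symm hW'
  obtain ⟨r, hr, hball⟩ := Metric.isOpen_iff.1 hW't (e (h 0))
    ⟨e.map_source (hVs h0), by simpa [e.left_inv (hVs h0)] using h0W'⟩
  have hmem : ∀ z ∈ Metric.ball (e (h 0)) r \ {e (h 0)}, e.symm z ∈ W' \ {h 0} := by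
    rintro z ⟨hz, hz0⟩
    refine ⟨(hball hz).2, fun h' => hz0 ?_⟩
    rw [mem_singleton_iff] at h' ⊢
    rw [← h', e.right_inv (hball hz).1]
  have hsymm : ContinuousOn e.symm (Metric.ball (e (h 0)) r \ {e (h 0)}) :=
    e.continuousOn_symm.mono fun z hz => (hball hz.1).1
  refine not_exists_log_sub_punctured_ball hr (a := e (h 0))
    ⟨fun z => l (e.symm z) + m (e.symm z), ?_, fun z hz => ?_⟩
  · exact (hl.comp hsymm fun z hz => ⟨(hW'sub (hmem z hz).1).2, (hmem z hz).2⟩).add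
      (hm.comp hsymm fun z hz => (hmem z hz).1)
  · have h1 := hmem z hz
    have h2 := hW'sub h1.1
    have h3 := hme _ h1.1
    rw [Complex.exp_add, hle _ ⟨h2.2, h1.2⟩, hφe _ h2.1, h3, div_mul_cancel₀,
      e.right_inv (hball hz.1).1]
    rw [← h3]
    exact Complex.exp_ne_zero _

/-- A winding function can be extended along a further subarc contained in a chart domain. -/
theorem HasWindingFunction.extend [T2Space Y] [NormalSpace Y] (e : OpenPartialHomeomorph Y ℂ)
    {h : ℝ → Y} {s t : ℝ} (hs : 0 < s) (hst : s < t) (hc : ContinuousOn h (Icc 0 t))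
    (hi : InjOn h (Icc 0 t)) (hsub : h '' Icc s t ⊆ e.source) (H : HasWindingFunction h s) :
    HasWindingFunction h t := by
  classical
  obtain ⟨ψ, Θ, hψ, hΘ, hΘ0, hΘψ, hΘn⟩ := H
  obtain ⟨ψ₀, φ, hψ₀, hφ, hφ0, hφψ, V, hV, hAV, hVs, hφe⟩ :=
    exists_winding_chart e hst.le (hc.mono (Icc_subset_Icc_left hs.le)) hsub
  have m0 : (0 : ℝ) ∈ Icc 0 t := ⟨le_rfl, (hs.trans hst).le⟩
  have ms : s ∈ Icc 0 t := ⟨hs.le, hst.le⟩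
  have mt : t ∈ Icc 0 t := ⟨(hs.trans hst).le, le_rfl⟩
  have n0s : h 0 ≠ h s := fun h' => hs.ne (hi m0 ms h')
  have n0t : h 0 ≠ h t := fun h' => (hs.trans hst).ne (hi m0 mt h')
  have nst : h s ≠ h t := fun h' => hst.ne (hi ms mt h')
  have hsV : h s ∈ V := hAV (mem_image_of_mem _ (left_mem_Icc.2 hst.le))
  have hts : h t ∈ e.source := hsub (mem_image_of_mem _ (right_mem_Icc.2 hst.le))
  set a := e (h s) with ha
  have hne : e (h s) - e (h t) ≠ 0 := fun h' => nst (e.injOn (hVs hsV) hts (sub_eq_zero.1 h'))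
  -- a logarithm of `e x - e (h t)` near `h s`
  have hO : V ∩ {h 0, h t}ᶜ ∈ 𝓝 (h s) :=
    inter_mem (hV.mem_nhds hsV) ((Set.toFinite _).isClosed.isOpen_compl.mem_nhds
      (by simp [n0s.symm, nst]))
  obtain ⟨W', hW', hsW', hW'sub, m, hm, hme⟩ := exists_continuousOn_log_nhds
    (p := h s) (g := fun x => e x - e (h t)) hO
    ((e.continuousOn.mono fun x hx => hVs hx.1).sub continuousOn_const) hne
  have hW't : IsOpen (e.target ∩ e.symm ⁻¹' W') := e.isOpen_inter_preimage_symm hW'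
  obtain ⟨r, hr, hball⟩ := Metric.isOpen_iff.1 hW't a
    ⟨e.map_source (hVs hsV), by simpa [ha, e.left_inv (hVs hsV)] using hsW'⟩
  have hmem : ∀ z ∈ Metric.ball a r \ {a}, e.symm z ∈ W' \ {h s} := by
    rintro z ⟨hz, hz0⟩
    refine ⟨(hball hz).2, fun h' => hz0 ?_⟩
    rw [mem_singleton_iff] at h' ⊢
    rw [ha, ← h', e.right_inv (hball hz).1]
  have hΘmem : ∀ z ∈ Metric.ball a r \ {a}, e.symm z ∈ ({h 0, h s} : Set Y)ᶜ := fun z hz => by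
    have h1 := hmem z hz
    have h2 := (hW'sub h1.1).2
    have h3 := h1.2
    simp only [mem_compl_iff, mem_insert_iff, mem_singleton_iff, not_or] at h2 h3 ⊢
    exact ⟨h2.1, h3⟩
  obtain ⟨n, l, hl, hle⟩ := exists_eq_zpow_mul_exp_punctured_ball hr (a := a)
    (g := fun z => Θ (e.symm z))
    (hΘ.comp (e.continuousOn_symm.mono fun z hz => (hball hz.1).1) hΘmem)
    (fun z hz => hΘ0 _ (hΘmem z hz))
  -- the neighbourhood of `h s` on which the modification takes place
  set N : Set Y := e.source ∩ e ⁻¹' Metric.ball a r with hN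
  have hNo : IsOpen N := e.isOpen_inter_preimage Metric.isOpen_ball
  have hNW : N ⊆ W' := fun x hx => by
    have := (hball hx.2).2
    rwa [mem_preimage, e.left_inv hx.1] at this
  have hsN : h s ∈ N := ⟨hVs hsV, Metric.mem_ball_self hr⟩
  have hNmem : ∀ x ∈ N \ {h s}, e x ∈ Metric.ball a r \ {a} := fun x hx =>
    ⟨hx.1.2, fun h' => hx.2 (e.injOn hx.1.1 (hVs hsV) h')⟩
  set L : Y → ℂ := fun x => l (e x) + n * m x with hL
  have hLc : ContinuousOn L (N \ {h s}) :=
    (hl.comp (e.continuousOn.mono fun x hx => hx.1.1) hNmem).add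
      (continuousOn_const.mul (hm.mono fun x hx => hNW hx.1))
  have hLe : ∀ x ∈ N \ {h s}, Θ x * φ x ^ (-n) = Complex.exp (L x) := fun x hx => by
    have h1 := hle _ (hNmem x hx)
    have hxW := hNW hx.1
    have h2 := hme x hxW
    have h3 : e x - a ≠ 0 := sub_ne_zero.2 (hNmem x hx).2
    have h4 : e x - e (h t) ≠ 0 := by rw [← h2]; exact Complex.exp_ne_zero _
    simp only [e.left_inv hx.1.1] at h1
    rw [h1, hφe x (hW'sub hxW).1, hL, Complex.exp_add, Complex.exp_int_mul, h2, div_zpow,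
      zpow_neg, zpow_neg]
    have h5 := zpow_ne_zero n h3
    have h6 := zpow_ne_zero n h4
    field_simp
  obtain ⟨χ, hχ, ⟨V₁, hV₁, hsV₁, hV₁N, hχ1⟩, V', hV', hNV', hχ0⟩ :=
    exists_continuous_cutoff (K := {h s}) isClosed_singleton hNo (singleton_subset_iff.2 hsN)
  have hχL : ContinuousOn (fun x => χ x * L x) {h s}ᶜ :=
    continuousOn_cutoff_mul isClosed_singleton hNo hχ hV' hNV' hχ0 hLc
  have hsub0 : h '' Icc 0 s ⊆ h '' Icc 0 t := image_mono (Icc_subset_Icc_right hst.le)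
  have hsub1 : h '' Icc s t ⊆ h '' Icc 0 t := image_mono (Icc_subset_Icc_left hs.le)
  set Θ' : Y → ℂ := fun x => Θ x * φ x ^ (-n) * Complex.exp (-(χ x * L x)) with hΘ'
  have hΘ'c : ContinuousOn Θ' {h 0, h s, h t}ᶜ := by
    have i1 : ({h 0, h s, h t} : Set Y)ᶜ ⊆ {h 0, h s}ᶜ := compl_subset_compl.2 (by
      intro x hx; simp only [mem_insert_iff, mem_singleton_iff] at hx ⊢; tauto)
    have i2 : ({h 0, h s, h t} : Set Y)ᶜ ⊆ {h s, h t}ᶜ := compl_subset_compl.2 (by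
      intro x hx; simp only [mem_insert_iff, mem_singleton_iff] at hx ⊢; tauto)
    have i3 : ({h 0, h s, h t} : Set Y)ᶜ ⊆ {h s}ᶜ := compl_subset_compl.2 (by
      intro x hx; simp only [mem_insert_iff, mem_singleton_iff] at hx ⊢; tauto)
    exact ((hΘ.mono i1).mul ((hφ.mono i2).zpow₀ _ fun x hx => Or.inl (hφ0 x (i2 hx)))).mul
      (hχL.mono i3).neg.cexp
  have hΘ'1 : ∀ x ∈ V₁ \ {h s}, Θ' x = 1 := fun x hx => by
    simp only [hΘ']
    rw [hLe x ⟨hV₁N hx.1, hx.2⟩, hχ1 x hx.1, one_mul, ← Complex.exp_add, add_neg_cancel,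
      Complex.exp_zero]
  refine ⟨fun x => ψ x + (-n : ℤ) * ψ₀ x + -(χ x * L x), fun x => if x = h s then 1 else Θ' x,
    ?_, fun x hx => ContinuousAt.continuousWithinAt ?_, fun x hx => ?_, fun x hx => ?_, ?_⟩
  · refine ((hψ.mono (compl_subset_compl.2 hsub0)).add
      (continuousOn_const.mul (hψ₀.mono (compl_subset_compl.2 hsub1)))).add
      (hχL.mono (compl_subset_compl.2 ?_)).neg
    exact singleton_subset_iff.2 (mem_image_of_mem _ ms)
  · by_cases hxs : x = h s
    · refine (continuousAt_const (y := (1 : ℂ))).congr ?_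
      filter_upwards [hV₁.mem_nhds (hxs ▸ hsV₁ rfl)] with y hy
      split_ifs with hys
      · rfl
      · exact (hΘ'1 y ⟨hy, hys⟩).symm
    · have h1 : ContinuousAt Θ' x := by
        refine hΘ'c.continuousAt ((Set.toFinite _).isClosed.isOpen_compl.mem_nhds ?_)
        simp only [mem_compl_iff, mem_insert_iff, mem_singleton_iff, not_or] at hx ⊢
        exact ⟨hx.1, hxs, hx.2⟩
      refine h1.congr ?_
      filter_upwards [isOpen_ne.mem_nhds hxs] with y hy
      rw [if_neg hy]
  · simp only [mem_compl_iff, mem_insert_iff, mem_singleton_iff, not_or] at hx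
    dsimp only
    split_ifs with hxs
    · exact one_ne_zero
    · exact mul_ne_zero (mul_ne_zero (hΘ0 x (by simp [hx.1, hxs]))
        (zpow_ne_zero _ (hφ0 x (by simp [hx.2, hxs])))) (Complex.exp_ne_zero _)
  · have hxs : x ≠ h s := fun h' => hx (h' ▸ mem_image_of_mem _ ms)
    dsimp only
    rw [if_neg hxs, Complex.exp_add, Complex.exp_add, Complex.exp_int_mul,
      ← hΘψ x fun h' => hx (hsub0 h'), ← hφψ x fun h' => hx (hsub1 h')]
  · rintro W hW ⟨k, hk, hke⟩
    have h0φ : h 0 ∈ ({h s, h t} : Set Y)ᶜ := by simp [n0s, n0t]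
    obtain ⟨W₂, hW₂, h0W₂, hW₂sub, q, hq, hqe⟩ := exists_continuousOn_log_nhds (p := h 0)
      (O := {h s, h t}ᶜ) ((Set.toFinite _).isClosed.isOpen_compl.mem_nhds h0φ) hφ (hφ0 _ h0φ)
    refine hΘn (W ∩ W₂) (inter_mem hW (hW₂.mem_nhds h0W₂))
      ⟨fun x => k x + n * q x + χ x * L x, ?_, fun x hx => ?_⟩
    · refine ((hk.mono fun x hx => ⟨hx.1.1, hx.2⟩).add
        (continuousOn_const.mul (hq.mono fun x hx => hx.1.2))).add (hχL.mono fun x hx => ?_)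
      have := hW₂sub hx.1.2
      simp only [mem_compl_iff, mem_insert_iff, mem_singleton_iff, not_or] at this ⊢
      exact this.1
    · have h1 := hW₂sub hx.1.2
      have h2 := hφ0 x h1
      simp only [mem_compl_iff, mem_insert_iff, mem_singleton_iff, not_or] at h1
      have h3 := zpow_ne_zero n h2
      have h4 := hke x ⟨hx.1.1, hx.2⟩
      simp only [if_neg h1.1] at h4
      rw [Complex.exp_add, Complex.exp_add, h4,
        Complex.exp_int_mul, hqe x hx.1.2, hΘ']
      dsimp only
      rw [Complex.exp_neg, zpow_neg]
      have := Complex.exp_ne_zero (χ x * L x)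
      field_simp

end Winding

/-! ### An arc crossing a simply connected open set separates it -/

section Separation

variable {Y : Type*} [TopologicalSpace Y] [ChartedSpace (EuclideanSpace ℝ (Fin 2)) Y]

theorem exists_complex_chart (y : Y) : ∃ e : OpenPartialHomeomorph Y ℂ, y ∈ e.source := by
  let E : EuclideanSpace ℝ (Fin 2) ≃L[ℝ] ℂ := ContinuousLinearEquiv.ofFinrankEq (by simp)
  exact ⟨(chartAt (EuclideanSpace ℝ (Fin 2)) y).transHomeomorph E.toHomeomorph,
    mem_chart_source _ y⟩

theorem hasWindingFunction_one [T2Space Y] [NormalSpace Y] {h : ℝ → Y}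
    (hc : ContinuousOn h (Icc 0 1)) (hi : InjOn h (Icc 0 1)) : HasWindingFunction h 1 := by
  choose e he using exists_complex_chart (Y := Y)
  have hI : Continuous fun τ : unitInterval => h τ :=
    hc.comp_continuous continuous_subtype_val fun τ => τ.2
  obtain ⟨t, ht0, htm, ⟨k, hk⟩, hcov⟩ := exists_monotone_Icc_subset_open_cover_unitInterval
    (c := fun y : Y => (fun τ : unitInterval => h τ) ⁻¹' (e y).source)
    (fun y => (e y).open_source.preimage hI) fun τ _ => mem_iUnion.2 ⟨h τ, he _⟩
  have hsub : ∀ n, ∃ y, h '' Icc (t n : ℝ) (t (n + 1)) ⊆ (e y).source := fun n => by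
    obtain ⟨y, hy⟩ := hcov n
    refine ⟨y, ?_⟩
    rintro _ ⟨τ, hτ, rfl⟩
    exact hy (a := ⟨τ, (t n).2.1.trans hτ.1, hτ.2.trans (t (n + 1)).2.2⟩) hτ
  have key : ∀ n, (t n : ℝ) = 0 ∨ HasWindingFunction h (t n) := by
    intro n
    induction n with
    | zero => left; simp [ht0]
    | succ n ih =>
      obtain ⟨y, hy⟩ := hsub n
      have hle : (t n : ℝ) ≤ t (n + 1) := htm n.le_succ
      have hI1 : Icc (0 : ℝ) (t (n + 1)) ⊆ Icc 0 1 := Icc_subset_Icc_right (t (n + 1)).2.2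
      rcases hle.eq_or_lt with heq | hlt
      · rwa [← heq]
      · right
        rcases (t n).2.1.eq_or_lt with h0 | h0
        · rw [← h0] at hlt hy
          exact hasWindingFunction_of_chart (e y) hlt (hc.mono hI1) (hi.mono hI1) hy
        · exact (ih.resolve_left h0.ne').extend (e y) h0 hlt (hc.mono hI1) (hi.mono hI1) hy
  have := key k
  rw [hk k le_rfl] at this
  simpa using this

/-- A simply connected open subset of a surface is separated by any arc which has its interior in
the set and its endpoints outside. -/
theorem not_isPreconnected_sdiff_arc [T2Space Y] [NormalSpace Y] {U : Set Y} (hU : IsOpen U)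
    (hsc : SimplyConnectedSpace U) {h : ℝ → Y} (hc : ContinuousOn h (Icc 0 1))
    (hi : InjOn h (Icc 0 1)) (hin : ∀ τ ∈ Ioo (0 : ℝ) 1, h τ ∈ U) (h0 : h 0 ∉ U)
    (h1 : h 1 ∉ U) : ¬IsPreconnected (U \ h '' Icc 0 1) := by
  classical
  intro hpre
  have : LocallyPathConnectedSpace Y :=
    ChartedSpace.locallyPathConnectedSpace (EuclideanSpace ℝ (Fin 2)) Y
  obtain ⟨ψ, Θ, hψ, hΘ, hΘ0, hΘψ, hΘn⟩ := hasWindingFunction_one hc hi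
  set A : Set Y := h '' Icc 0 1 with hA
  have hAc : IsClosed A := (isCompact_Icc.image_of_continuousOn hc).isClosed
  have hUsub : U ⊆ {h 0, h 1}ᶜ := by
    rintro x hx (rfl | rfl)
    exacts [h0 hx, h1 hx]
  obtain ⟨l, hl, hle⟩ := exists_continuousOn_log hU hsc (hΘ.mono hUsub)
    fun x hx => hΘ0 x (hUsub hx)
  have hexp : ∀ x ∈ U \ A, Complex.exp (ψ x) = Complex.exp (l x) := fun x hx => by
    rw [hle x hx.1, hΘψ x hx.2]
  obtain ⟨c, hc1, hcl⟩ : ∃ c : ℂ, Complex.exp c = 1 ∧ ∀ x ∈ U \ A, ψ x = l x + c := by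
    rcases (U \ A).eq_empty_or_nonempty with hem | ⟨x₀, hx₀⟩
    · exact ⟨0, Complex.exp_zero, by simp [hem]⟩
    · refine ⟨ψ x₀ - l x₀, ?_, fun x hx => ?_⟩
      · rw [Complex.exp_sub, hexp x₀ hx₀, div_self (Complex.exp_ne_zero _)]
      · linear_combination hpre.sub_eq_sub_of_exp_eq (hψ.mono fun x hx => hx.2)
          (hl.mono sdiff_subset) hexp hx hx₀
  have hne : h 0 ≠ h 1 := fun h' =>
    zero_ne_one (hi (left_mem_Icc.2 zero_le_one) (right_mem_Icc.2 zero_le_one) h')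
  have hcases : ∀ x ∈ ({h 1}ᶜ : Set Y) \ {h 0}, x ∉ U → x ∈ Aᶜ := by
    rintro x ⟨hx1, hx0⟩ hxU ⟨τ, hτ, rfl⟩
    refine hxU (hin τ ⟨hτ.1.lt_of_ne ?_, hτ.2.lt_of_ne ?_⟩)
    · rintro rfl; exact hx0 rfl
    · rintro rfl; exact hx1 rfl
  refine hΘn {h 1}ᶜ (isOpen_ne.mem_nhds hne) ⟨fun x => if x ∈ U then l x + c else ψ x,
    fun x hx => ContinuousAt.continuousWithinAt ?_, fun x hx => ?_⟩
  · by_cases hxU : x ∈ U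
    · refine ((hl.continuousAt (hU.mem_nhds hxU)).add (continuousAt_const (y := c))).congr ?_
      filter_upwards [hU.mem_nhds hxU] with y hy
      simp [hy]
    · have hxA := hAc.isOpen_compl.mem_nhds (hcases x hx hxU)
      refine (hψ.continuousAt hxA).congr ?_
      filter_upwards [hxA] with y hy
      split_ifs with hyU
      · exact hcl y ⟨hyU, hy⟩
      · rfl
  · dsimp only
    split_ifs with hxU
    · rw [Complex.exp_add, hc1, mul_one, hle x hxU]
    · exact (hΘψ x (hcases x hx hxU)).symm

end Separation

/-! ### Separating sets of measure preserving homeomorphisms recur -/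

section Recurrence

open MeasureTheory

variable {Y : Type*} [TopologicalSpace Y] [MeasurableSpace Y] [BorelSpace Y]

/-- Two disjoint separations of a connected set are strictly nested with respect to a measure
with full support. -/
theorem subset_and_measure_lt_of_separations {μ : Measure Y} [IsFiniteMeasure μ]
    (hfull : ∀ V : Set Y, IsOpen V → V.Nonempty → 0 < μ V) {U D S D' F E F' : Set Y}
    (hU : IsPreconnected U) (hD : IsOpen D) (hD' : IsOpen D') (hF : IsOpen F) (hF' : IsOpen F')
    (hDU : D ∪ S ∪ D' = U) (hFU : F ∪ E ∪ F' = U) (hDD' : Disjoint D D')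
    (hFF' : Disjoint F F') (hS : S.Nonempty) (hE : E.Nonempty)
    (hSF : S ⊆ F) (hED' : E ⊆ D') : D ⊆ F ∧ μ D < μ F := by
  have hDF : D ⊆ F := by
    by_contra hcon
    obtain ⟨y, hyD, hyF⟩ := not_subset.1 hcon
    have hyU : y ∈ U := hDU ▸ Or.inl (Or.inl hyD)
    have hyF' : y ∈ F' := by
      rcases hFU.symm ▸ hyU with (h | h) | h
      · exact absurd h hyF
      · exact absurd (hED' h) (disjoint_left.1 hDD' hyD)
      · exact h
    obtain ⟨s, hs⟩ := hS
    obtain ⟨z, -, ⟨hzD, hzF'⟩, hz⟩ := hU (D ∩ F') (D' ∪ F) (hD.inter hF') (hD'.union hF)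
      (fun z hz => by
        have h1 : z ∈ D ∪ S ∪ D' := hDU.symm ▸ hz
        have h2 : z ∈ F ∪ E ∪ F' := hFU.symm ▸ hz
        have h3 := @hSF z
        have h4 := @hED' z
        simp only [mem_union, mem_inter_iff] at h1 h2 ⊢
        tauto)
      ⟨y, hyU, hyD, hyF'⟩ ⟨s, hDU ▸ Or.inl (Or.inr hs), Or.inr (hSF hs)⟩
    rcases hz with hz | hz
    · exact disjoint_left.1 hDD' hzD hz
    · exact disjoint_left.1 hFF' hz hzF'
  refine ⟨hDF, ?_⟩
  obtain ⟨s, hs⟩ := hS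
  obtain ⟨w, hw⟩ := hE
  have hne : (F ∩ D').Nonempty := by
    obtain ⟨z, -, hz⟩ := hU F D' hF hD'
      (fun z hz => by
        rcases hDU.symm ▸ hz with (h | h) | h
        exacts [Or.inl (hDF h), Or.inl (hSF h), Or.inr h])
      ⟨s, hDU ▸ Or.inl (Or.inr hs), hSF hs⟩ ⟨w, hFU ▸ Or.inl (Or.inr hw), hED' hw⟩
    exact ⟨z, hz⟩
  calc μ D < μ D + μ (F ∩ D') :=
        ENNReal.lt_add_right (measure_ne_top μ D) (hfull _ (hF.inter hD') hne).ne'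
    _ = μ (D ∪ (F ∩ D')) :=
        (measure_union (hDD'.mono_right inter_subset_right) (hF.inter hD').measurableSet).symm
    _ ≤ μ F := measure_mono (union_subset hDF inter_subset_left)

/-- A connected subset separating an invariant connected open set meets one of its iterates. -/
theorem exists_iterate_image_inter_nonempty_of_separates {μ : Measure Y} [IsFiniteMeasure μ]
    (hfull : ∀ V : Set Y, IsOpen V → V.Nonempty → 0 < μ V) (f : Y ≃ₜ Y)
    (hf : MeasurePreserving f μ μ) {U S : Set Y} (hU : IsPreconnected U) (hfU : f '' U = U)
    (hSU : S ⊆ U) (hUS : IsOpen (U \ S)) (hS : IsConnected S) (hsep : ¬IsPreconnected (U \ S)) :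
    ∃ m : ℕ, 1 ≤ m ∧ (f^[m] '' S ∩ S).Nonempty := by
  by_contra! hcon
  obtain ⟨u, v, hu, hv, huv, hnu, hnv, hemp⟩ : ∃ u v : Set Y, IsOpen u ∧ IsOpen v ∧
      U \ S ⊆ u ∪ v ∧ (U \ S ∩ u).Nonempty ∧ (U \ S ∩ v).Nonempty ∧
      ¬(U \ S ∩ (u ∩ v)).Nonempty := by
    simpa only [IsPreconnected, not_forall, exists_prop] using hsep
  have main : ∀ D D' : Set Y, IsOpen D → IsOpen D' → D.Nonempty → Disjoint D D' →
      Disjoint D S → Disjoint D' S → D ∪ S ∪ D' = U → μ D ≤ μ D' → False := by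
    intro D D' hD hD' hDne hDD' hDS hD'S hDU hle
    obtain ⟨x, hx, m, hm, hmx⟩ := hf.exists_mem_iterate_mem hD.measurableSet.nullMeasurableSet
      (hfull D hD hDne).ne'
    have hm1 : 1 ≤ m := Nat.one_le_iff_ne_zero.2 hm
    set g := f^[m] with hg
    have hgo : IsOpenMap g := by
      rw [hg]
      clear_value g
      clear hmx hm1 hm hg
      induction m with
      | zero => exact IsOpenMap.id
      | succ m ih => exact ih.comp f.isOpenMap
    have hgi : Function.Injective g := f.injective.iterate m
    have hgμ : ∀ V : Set Y, IsOpen V → μ (g '' V) = μ V := fun V hV => by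
      rw [← (hf.iterate m).measure_preimage (hgo V hV).measurableSet.nullMeasurableSet,
        preimage_image_eq _ hgi]
    have hgU : g '' U = U := by
      rw [hg, image_iterate_eq]
      exact Function.iterate_fixed hfU m
    have hgDU : g '' D ∪ g '' S ∪ g '' D' = U := by
      rw [← image_union, ← image_union, hDU, hgU]
    have hgDD' : Disjoint (g '' D) (g '' D') := (disjoint_image_iff hgi).2 hDD'
    have hSS : Disjoint (g '' S) S := disjoint_iff_inter_eq_empty.2 (hcon m hm1)
    have hgS : IsConnected (g '' S) := hS.image _ (f.continuous.iterate m).continuousOn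
    have c1 : S ⊆ g '' D ∨ S ⊆ g '' D' := by
      refine hS.isPreconnected.subset_or_subset (hgo _ hD) (hgo _ hD') hgDD' fun y hy => ?_
      rcases hgDU.symm ▸ hSU hy with (h | h) | h
      exacts [Or.inl h, absurd hy (disjoint_left.1 hSS h), Or.inr h]
    have c2 : g '' S ⊆ D ∨ g '' S ⊆ D' := by
      refine hgS.isPreconnected.subset_or_subset hD hD' hDD' fun y hy => ?_
      have hyU : y ∈ U := hgDU ▸ Or.inl (Or.inr hy)
      rcases hDU.symm ▸ hyU with (h | h) | h
      exacts [Or.inl h, absurd h (disjoint_left.1 hSS hy), Or.inr h]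
    have hDU' : D' ∪ S ∪ D = U := by rw [← hDU, union_comm, union_comm D' S, union_assoc]
    have hgDU' : g '' D' ∪ g '' S ∪ g '' D = U := by
      rw [← hgDU, union_comm, union_comm (g '' D') (g '' S), union_assoc]
    rcases c1 with c1 | c1 <;> rcases c2 with c2 | c2
    · have := (subset_and_measure_lt_of_separations hfull hU hD' hD (hgo _ hD) (hgo _ hD') hDU'
        hgDU hDD'.symm hgDD' hS.nonempty hgS.nonempty c1 c2).2
      rw [hgμ D hD] at this
      exact this.not_ge hle
    · have := (subset_and_measure_lt_of_separations hfull hU hD hD' (hgo _ hD) (hgo _ hD') hDU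
        hgDU hDD' hgDD' hS.nonempty hgS.nonempty c1 c2).2
      rw [hgμ D hD] at this
      exact this.false
    · have := (subset_and_measure_lt_of_separations hfull hU hD' hD (hgo _ hD') (hgo _ hD) hDU'
        hgDU' hDD'.symm hgDD'.symm hS.nonempty hgS.nonempty c1 c2).2
      rw [hgμ D' hD'] at this
      exact this.false
    · have := (subset_and_measure_lt_of_separations hfull hU hD hD' (hgo _ hD') (hgo _ hD) hDU
        hgDU' hDD' hgDD'.symm hS.nonempty hgS.nonempty c1 c2).1
      exact disjoint_left.1 hgDD' (mem_image_of_mem g hx) (this hmx)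
  have hd : Disjoint (U \ S ∩ u) (U \ S ∩ v) :=
    disjoint_left.2 fun y h1 h2 => hemp ⟨y, h1.1, h1.2, h2.2⟩
  have hdS : ∀ w : Set Y, Disjoint (U \ S ∩ w) S := fun w => disjoint_left.2 fun y h1 => h1.1.2
  have hcov : U \ S ∩ u ∪ S ∪ (U \ S ∩ v) = U := by
    ext y
    have h1 := @huv y
    have h2 := @hSU y
    simp only [mem_union, mem_inter_iff, Set.mem_sdiff] at h1 ⊢
    tauto
  have hcov' : U \ S ∩ v ∪ S ∪ (U \ S ∩ u) = U := by
    rw [union_comm, union_comm _ S, ← union_assoc]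
    exact hcov
  rcases le_total (μ (U \ S ∩ u)) (μ (U \ S ∩ v)) with hle | hle
  · exact main _ _ (hUS.inter hu) (hUS.inter hv) hnu hd (hdS _) (hdS _) hcov hle
  · exact main _ _ (hUS.inter hv) (hUS.inter hu) hnv hd.symm (hdS _) (hdS _) hcov' hle

end Recurrence

/-! ### Infinite translation arcs -/

section TranslationArc

variable {Y : Type u} [TopologicalSpace Y]

theorem IsInfTranslationArc.exists_param {f : Y ≃ₜ Y} {γ : Set Y} {x : Y}
    (h : IsInfTranslationArc f γ x) :
    ∃ g : ℝ → Y, ContinuousOn g (Icc 0 1) ∧ InjOn g (Icc 0 1) ∧ γ = g '' Icc 0 1 ∧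
      g 1 = f (g 0) ∧ ∀ k : ℕ, 1 ≤ k → ∀ s ∈ Icc (0 : ℝ) 1, ∀ t ∈ Icc (0 : ℝ) 1,
        f^[k] (g s) = g t → k = 1 ∧ s = 0 ∧ t = 1 := by
  obtain ⟨-, g, hc, hi, h0, h1, hγ, hinter⟩ := (h 1 le_rfl).1
  have hdisj : ∀ k : ℕ, 2 ≤ k → f^[k] '' γ ∩ γ = ∅ := fun k hk =>
    ((h (k + 1) (by omega)).2 (by omega)).1 k hk (by omega)
  have hx : x ∈ γ := hγ ▸ ⟨0, left_mem_Icc.2 zero_le_one, h0⟩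
  have hinter' : f '' γ ∩ γ = {f x} := by
    refine hinter.resolve_right fun hcon => ?_
    have : x ∈ f^[2] '' γ ∩ γ := ⟨⟨x, hx, hcon.2⟩, hx⟩
    rwa [hdisj 2 le_rfl] at this
  refine ⟨g, hc, hi, hγ, by rw [h1, h0], fun k hk s hs t ht hst => ?_⟩
  have hsγ : g s ∈ γ := hγ ▸ mem_image_of_mem g hs
  have htγ : g t ∈ γ := hγ ▸ mem_image_of_mem g ht
  obtain rfl : k = 1 := by
    by_contra hk1
    have : g t ∈ f^[k] '' γ ∩ γ := ⟨⟨g s, hsγ, hst⟩, htγ⟩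
    rwa [hdisj k (by omega)] at this
  have hft : g t = f x := by
    have : g t ∈ f '' γ ∩ γ := ⟨⟨g s, hsγ, hst⟩, htγ⟩
    rwa [hinter'] at this
  refine ⟨rfl, hi hs (left_mem_Icc.2 zero_le_one) ?_, hi ht (right_mem_Icc.2 zero_le_one) ?_⟩
  · rw [h0]
    exact f.injective (hst.trans hft)
  · rw [hft, h1]

/-- The concatenation of an infinite translation arc with its image, as a path on `[0, 2]`. -/
theorem IsInfTranslationArc.exists_double_param {f : Y ≃ₜ Y} {γ : Set Y} {x : Y}
    (h : IsInfTranslationArc f γ x) :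
    ∃ G : ℝ → Y, ContinuousOn G (Icc 0 2) ∧ InjOn G (Icc 0 2) ∧ γ = G '' Icc 0 1 ∧
      (∀ t ∈ Icc (0 : ℝ) 1, G (t + 1) = f (G t)) ∧
      ∀ m : ℕ, 1 ≤ m → ∀ s ∈ Icc (0 : ℝ) 2, ∀ t ∈ Icc (0 : ℝ) 2, |t - s| < 1 →
        f^[m] (G s) ≠ G t := by
  obtain ⟨g, hc, hi, hγ, hg1, hg⟩ := h.exists_param
  set G : ℝ → Y := fun t => if t ≤ 1 then g t else f (g (t - 1)) with hG
  have hG1 : ∀ t, t ≤ 1 → G t = g t := fun t ht => if_pos ht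
  have hG2 : ∀ t, 1 ≤ t → G t = f (g (t - 1)) := fun t ht => by
    rcases ht.eq_or_lt with rfl | ht
    · rw [hG1 1 le_rfl, hg1, sub_self]
    · exact if_neg ht.not_ge
  have hrep : ∀ t ∈ Icc (0 : ℝ) 2, ∃ j : ℕ, ∃ s ∈ Icc (0 : ℝ) 1, j ≤ 1 ∧ t = j + s ∧
      G t = f^[j] (g s) := by
    intro t ht
    rcases le_total t 1 with h1 | h1
    · exact ⟨0, t, ⟨ht.1, h1⟩, by simp, by simp, hG1 t h1⟩
    · exact ⟨1, t - 1, ⟨by linarith, by linarith [ht.2]⟩, le_rfl, by simp, hG2 t h1⟩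
  have hkey : ∀ k : ℕ, ∀ s ∈ Icc (0 : ℝ) 1, ∀ t ∈ Icc (0 : ℝ) 1, f^[k] (g s) = g t →
      t = s + k := by
    intro k s hs t ht hst
    rcases Nat.eq_zero_or_pos k with rfl | hk
    · simpa using (hi hs ht hst).symm
    · obtain ⟨rfl, rfl, rfl⟩ := hg k hk s hs t ht hst
      simp
  have hmain : ∀ m : ℕ, ∀ s ∈ Icc (0 : ℝ) 2, ∀ t ∈ Icc (0 : ℝ) 2, f^[m] (G s) = G t →
      t = s + m := by
    intro m s hs t ht hst
    obtain ⟨i, s, hs', hi1, rfl, hGs⟩ := hrep s hs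
    obtain ⟨j, t, ht', hj1, rfl, hGt⟩ := hrep t ht
    rw [hGs, hGt, ← Function.iterate_add_apply] at hst
    rcases le_total j (m + i) with hle | hle
    · obtain ⟨k, hk⟩ := Nat.exists_eq_add_of_le hle
      rw [hk, Function.iterate_add_apply] at hst
      have := hkey k s hs' t ht' (f.injective.iterate j hst)
      have hk' : (m + i : ℝ) = j + k := by exact_mod_cast hk
      linarith
    · obtain ⟨k, hk⟩ := Nat.exists_eq_add_of_le hle
      rw [hk, Function.iterate_add_apply f (m + i)] at hst
      have := hkey k t ht' s hs' (f.injective.iterate (m + i) hst).symm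
      have hk' : (j : ℝ) = m + i + k := by exact_mod_cast hk
      linarith
  refine ⟨G, ?_, fun s hs t ht hst => ?_, ?_, fun t ht => ?_, fun m hm s hs t ht hst heq => ?_⟩
  · have hu : Icc (0 : ℝ) 2 = Icc 0 1 ∪ Icc 1 2 :=
      (Icc_union_Icc_eq_Icc zero_le_one one_le_two).symm
    rw [hu]
    refine ContinuousOn.union_of_isClosed ?_ ?_ isClosed_Icc isClosed_Icc
    · exact hc.congr fun t ht => hG1 t ht.2
    · refine (f.continuous.comp_continuousOn (hc.comp (by fun_prop) fun t ht => ?_)).congr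
        fun t ht => hG2 t ht.1
      exact ⟨by linarith [ht.1], by linarith [ht.2]⟩
  · simpa using (hmain 0 s hs t ht hst).symm
  · rw [hγ]
    exact image_congr fun t ht => (hG1 t ht.2).symm
  · rw [hG2 _ (by linarith [ht.1]), hG1 t ht.2, add_sub_cancel_right]
  · have := hmain m s hs t ht heq
    have hm' : (1 : ℝ) ≤ m := by exact_mod_cast hm
    linarith [le_abs_self (t - s)]

/-- An infinite translation arc crossing the boundary of an invariant open set yields a
cross-cut of that set which is disjoint from its forward iterates. -/
theorem IsInfTranslationArc.exists_disjoint_arc {f : Y ≃ₜ Y} {γ : Set Y} {x : Y}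
    (h : IsInfTranslationArc f γ x) {U : Set Y} (hU : IsOpen U) (hfU : f '' U = U)
    (hγU : (γ ∩ U).Nonempty) (hγU' : (γ ∩ Uᶜ).Nonempty) :
    ∃ c : ℝ → Y, ContinuousOn c (Icc 0 1) ∧ InjOn c (Icc 0 1) ∧ (∀ τ ∈ Ioo (0 : ℝ) 1, c τ ∈ U) ∧
      c 0 ∉ U ∧ c 1 ∉ U ∧
      ∀ m : ℕ, 1 ≤ m → f^[m] '' (c '' Ioo 0 1) ∩ c '' Ioo 0 1 = ∅ := by
  obtain ⟨G, hc, hi, rfl, hG, hd⟩ := h.exists_double_param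
  have hinv : ∀ y, f y ∈ U ↔ y ∈ U := fun y => by
    conv_lhs => rw [← hfU]
    exact f.injective.mem_set_image
  obtain ⟨_, ⟨p, hp, rfl⟩, hpU⟩ := hγU'
  obtain ⟨_, ⟨q, hq, rfl⟩, hqU⟩ := hγU
  have hp1 : G (p + 1) ∉ U := by rwa [hG p hp, hinv]
  obtain ⟨r, hr, hrU⟩ : ∃ r ∈ Icc p (p + 1), G r ∈ U := by
    rcases le_total p q with hpq | hpq
    · exact ⟨q, ⟨hpq, by linarith [hp.1, hq.2]⟩, hqU⟩
    · exact ⟨q + 1, ⟨by linarith [hp.2, hq.1], by linarith⟩, by rwa [hG q hq, hinv]⟩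
  have hcpt : ∀ u v : ℝ, 0 ≤ u → v ≤ 2 → IsCompact (Icc u v ∩ G ⁻¹' Uᶜ) := fun u v hu hv =>
    isCompact_Icc.of_isClosed_subset ((hc.mono (Icc_subset_Icc hu hv)).preimage_isClosed_of_isClosed
      isClosed_Icc hU.isClosed_compl) inter_subset_left
  obtain ⟨a, ⟨⟨hpa, har⟩, haU⟩, hamax⟩ := (hcpt p r hp.1 (by linarith [hr.2, hp.2])).exists_isGreatest
    ⟨p, left_mem_Icc.2 hr.1, hpU⟩
  obtain ⟨b, ⟨⟨hrb, hbp⟩, hbU⟩, hbmin⟩ := (hcpt r (p + 1) (hp.1.trans hr.1)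
    (by linarith [hp.2])).exists_isLeast ⟨p + 1, right_mem_Icc.2 hr.2, hp1⟩
  have har' : a < r := har.lt_of_ne fun h' => haU (h' ▸ hrU)
  have hrb' : r < b := hrb.lt_of_ne fun h' => hbU (h' ▸ hrU)
  have hab : 0 < b - a := by linarith
  have hin : ∀ t ∈ Ioo a b, G t ∈ U := by
    intro t ht
    by_contra hcon
    rcases le_total t r with htr | htr
    · exact (hamax ⟨⟨hpa.trans ht.1.le, htr⟩, hcon⟩).not_gt ht.1
    · exact (hbmin ⟨⟨htr, ht.2.le.trans hbp⟩, hcon⟩).not_gt ht.2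
  have hmaps : MapsTo (fun τ => a + τ * (b - a)) (Icc 0 1) (Icc (0 : ℝ) 2) := fun τ hτ =>
    ⟨by nlinarith [hτ.1, hp.1], by nlinarith [hτ.2, hp.2]⟩
  refine ⟨fun τ => G (a + τ * (b - a)), hc.comp (by fun_prop) hmaps, fun s hs t ht hst => ?_,
    fun τ hτ => hin _ ⟨by nlinarith [hτ.1], by nlinarith [hτ.2]⟩, by simpa using haU,
    by simpa using hbU, fun m hm => ?_⟩
  · have := hi (hmaps hs) (hmaps ht) hst
    exact mul_right_cancel₀ hab.ne' (add_left_cancel this)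
  · refine eq_empty_of_forall_notMem ?_
    rintro _ ⟨⟨_, ⟨s, hs, rfl⟩, heq⟩, ⟨t, ht, rfl⟩⟩
    refine hd m hm _ (hmaps (Ioo_subset_Icc_self hs)) _ (hmaps (Ioo_subset_Icc_self ht))
      ?_ heq
    rw [abs_lt]
    constructor <;> nlinarith [hs.1, hs.2, ht.1, ht.2]

end TranslationArc

/-- On a closed surface, a homeomorphism preserving a finite Borel measure
of full support admits no ∞-translation arc intersecting both an invariant open simply
connected set `U` (with `S ∖ U` nontrivial) and its complement. -/
theorem no_inf_translation_arc_crossing_boundary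
    {X : Type*} [TopologicalSpace X] [T2Space X] [CompactSpace X] [ConnectedSpace X]
    [ChartedSpace (EuclideanSpace ℝ (Fin 2)) X]
    [MeasurableSpace X] [BorelSpace X]
    (f : X ≃ₜ X) (μ : MeasureTheory.Measure X) [MeasureTheory.IsFiniteMeasure μ]
    (hpres : MeasureTheory.MeasurePreserving f μ μ)
    (hfull : ∀ V : Set X, IsOpen V → V.Nonempty → 0 < μ V)
    (U : Set X) (hUopen : IsOpen U) (hUsc : SimplyConnectedSpace ↥U)
    (hUinv : ⇑f '' U = U) (hUcompl : Set.Nontrivial Uᶜ) :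
    ¬∃ (γ : Set X) (x : X),
      IsInfTranslationArc f γ x ∧ (γ ∩ U).Nonempty ∧ (γ ∩ Uᶜ).Nonempty := by
  rintro ⟨γ, x, hγ, hγU, hγU'⟩
  obtain ⟨c, hc, hi, hin, h0, h1, hdisj⟩ := hγ.exists_disjoint_arc hUopen hUinv hγU hγU'
  have hU : IsPreconnected U := isPreconnected_iff_preconnectedSpace.2 inferInstance
  have hsd : U \ c '' Icc 0 1 = U \ c '' Ioo 0 1 := by
    refine Subset.antisymm (sdiff_subset_sdiff_right (image_mono Ioo_subset_Icc_self)) ?_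
    rintro y ⟨hy, hyc⟩
    refine ⟨hy, ?_⟩
    rintro ⟨τ, hτ, rfl⟩
    refine hyc ⟨τ, ⟨hτ.1.lt_of_ne ?_, hτ.2.lt_of_ne ?_⟩, rfl⟩
    · rintro rfl; exact h0 hy
    · rintro rfl; exact h1 hy
  have hsep := not_isPreconnected_sdiff_arc hUopen hUsc hc hi hin h0 h1
  have hopen : IsOpen (U \ c '' Icc 0 1) :=
    hUopen.sdiff (isCompact_Icc.image_of_continuousOn hc).isClosed
  rw [hsd] at hsep hopen
  obtain ⟨m, hm, hne⟩ := exists_iterate_image_inter_nonempty_of_separates hfull f hpres hU hUinv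
    (image_subset_iff.2 hin) hopen
    ((isConnected_Ioo zero_lt_one).image c (hc.mono Ioo_subset_Icc_self)) hsep
  exact hne.ne_empty (hdisj m hm)

end
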